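/- arXiv:1803.03794 — 3 statements merged into one kernel-verified Lean document; each statement's English description precedes it below -/
import Mathlib

section
/- Consistency of the monotone spatial discretization (Lemma 4.2): suppose Assumption (A) holds and in addition sup_{α∈A, x∈ℝ^d}(|b(α,x)| + |σ(α,x)|) < ∞. Fix α ∈ A and t ∈ [0,T], and let φ ∈ C^{1,2}([0,T]×ℝ^d) be such that Dφ(t,·) and D²φ(t,·) are bounded on ℝ^d and D²φ(t,·) is uniformly continuous. Then there exist a constant C' > 0 and a function ω : (0,∞) → [0,∞) with ω(k) → 0 as k → 0, both independent of h, k and ε, such that for all ε ∈ (0,1), all h, k > 0 and all i ∈ ℤ^d: (i) | A_{ε,h,k}φ(t,·)(x_i) + K¹_{ε,h}φ(t,·)(x_i) − [ ½ tr(σ̃(α,x_i)σ̃(α,x_i)ᵀ D²φ(t,x_i)) + b(α,x_i)·Dφ(t,x_i) + K_ε^αφ(t,x_i) ] | ≤ C'( h²/k² + h²/ε² + k²/ε² + ω(k) ); and (ii) | B_{ε,h}φ(t,·)(x_i) − B_ε^αφ(t,x_i) | ≤ C' h²/ε. -/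
open MeasureTheory Set Filter Topology Metric
open scoped RealInnerProductSpace Matrix

attribute [local instance] Matrix.normedAddCommGroup Matrix.normedSpace

noncomputable section

abbrev Vec (d : ℕ) := EuclideanSpace ℝ (Fin d)

structure C12 (d : ℕ) where
  toFun : ℝ → Vec d → ℝ
  dt : ℝ → Vec d → ℝ
  grad : ℝ → Vec d → Vec d
  hess : ℝ → Vec d → Matrix (Fin d) (Fin d) ℝ
  hasDt : ∀ t x, HasDerivAt (fun s => toFun s x) (dt t x) t
  hasGrad : ∀ t x, HasGradientAt (toFun t) (grad t x) x
  hasHess : ∀ t x, HasFDerivAt (grad t)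
      ((Matrix.toEuclideanLin (hess t x)).toContinuousLinearMap) x
  cont : Continuous fun p : ℝ × Vec d => toFun p.1 p.2
  cont_dt : Continuous fun p : ℝ × Vec d => dt p.1 p.2
  cont_grad : Continuous fun p : ℝ × Vec d => grad p.1 p.2
  cont_hess : Continuous fun p : ℝ × Vec d => hess p.1 p.2

def mvE {d : ℕ} (M : Matrix (Fin d) (Fin d) ℝ) (v : Vec d) : Vec d :=
  (EuclideanSpace.equiv (Fin d) ℝ).symm (M.mulVec ((EuclideanSpace.equiv (Fin d) ℝ) v))

variable {n d m : ℕ}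

/-- Assumption (A) of the paper. -/
structure AssumptionA (ν : Measure (Vec n)) (A : Set (Vec m)) (T : ℝ)
    (b : Vec m → Vec d → Vec d) (σ : Vec m → Vec d → Matrix (Fin d) (Fin d) ℝ)
    (η : Vec m → Vec d → Vec n → Vec d) (γ : Vec d → Vec n → ℝ)
    (f : Vec m → ℝ → Vec d → ℝ → Vec d → ℝ → ℝ)
    (ζ : ℝ → Vec d → ℝ) (g : Vec d → ℝ) (C : ℝ) : Prop where
  hC : 0 < C
  hT : 0 < T
  hAcpt : IsCompact A
  hAne : A.Nonempty
  hν_sf : SigmaFinite ν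
  hν_zero : ν {0} = 0
  hν_int : Integrable (fun e => min 1 (‖e‖ ^ 2)) ν
  hη_meas : ∀ α x, Measurable (η α x)
  hγ_meas : ∀ x, Measurable (γ x)
  hb : ∀ α ∈ A, ∀ α' ∈ A, ∀ x x' : Vec d,
      ‖b α x - b α' x'‖ + ‖σ α x - σ α' x'‖ ≤ C * (‖x - x'‖ + ‖α - α'‖)
  hη_lip : ∀ α ∈ A, ∀ α' ∈ A, ∀ (x x' : Vec d) (e : Vec n),
      ‖η α x e - η α' x' e‖ ≤ C * (‖x - x'‖ + ‖α - α'‖) * min 1 ‖e‖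
  hη_bdd : ∀ α ∈ A, ∀ (x : Vec d) (e : Vec n), ‖η α x e‖ ≤ C * min 1 ‖e‖
  hγ_lip : ∀ (x x' : Vec d) (e : Vec n),
      |γ x e - γ x' e| ≤ C * ‖x - x'‖ * min 1 (‖e‖ ^ 2)
  hγ_nonneg : ∀ x e, 0 ≤ γ x e
  hγ_bdd : ∀ (x : Vec d) (e : Vec n), γ x e ≤ C * min 1 ‖e‖
  hf_t_cont : ∀ α x u p k, Continuous fun t => f α t x u p k
  hf_bdd : ∀ α ∈ A, ∀ t ∈ Icc (0:ℝ) T, ∀ x : Vec d, |f α t x 0 0 0| ≤ C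
  hf_mono : ∀ α ∈ A, ∀ t ∈ Icc (0:ℝ) T, ∀ (x : Vec d) (p : Vec d) (k u v : ℝ),
      v ≤ u → C * (u - v) ≤ f α t x v p k - f α t x u p k
  hf_k_mono : ∀ α ∈ A, ∀ t ∈ Icc (0:ℝ) T, ∀ (x : Vec d) (u : ℝ) (p : Vec d),
      Monotone fun k => f α t x u p k
  hf_lip : ∀ α ∈ A, ∀ α' ∈ A, ∀ t ∈ Icc (0:ℝ) T, ∀ (x : Vec d) (u v : ℝ) (p q : Vec d) (k k' : ℝ),
      |f α t x u p k - f α' t x v q k'| ≤ C * (‖α - α'‖ + |u - v| + ‖p - q‖ + |k - k'|)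
  hf_x : ∀ R > (0:ℝ), ∃ mR : ℝ → ℝ, Continuous mR ∧ mR 0 = 0 ∧ (∀ r, 0 ≤ mR r) ∧
      ∀ α ∈ A, ∀ t ∈ Icc (0:ℝ) T, ∀ (x x' : Vec d) (u : ℝ) (p : Vec d) (k : ℝ),
        ‖x‖ ≤ R → ‖x'‖ ≤ R → |u| ≤ R →
        |f α t x u p k - f α t x' u p k| ≤ mR (‖x - x'‖ * (1 + ‖p‖))
  hζ_t_cont : ∀ x, Continuous fun t => ζ t x
  hζg_lip : ∀ (t : ℝ) (x x' : Vec d), |g x - g x'| + |ζ t x - ζ t x'| ≤ C * ‖x - x'‖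
  hζg_bdd : ∀ (t : ℝ) (x : Vec d), |g x| + |ζ t x| ≤ C
  hgζ : ∀ x, ζ 0 x ≤ g x

/-- The nonlocal operator `K^α`. -/
def Kop (ν : Measure (Vec n)) (η : Vec m → Vec d → Vec n → Vec d)
    (φ : C12 d) (α : Vec m) (t : ℝ) (x : Vec d) : ℝ :=
  ∫ e, (φ.toFun t (x + η α x e) - φ.toFun t x - ⟪η α x e, φ.grad t x⟫) ∂ν

/-- The nonlocal operator `B^α`. -/
def Bop (ν : Measure (Vec n)) (η : Vec m → Vec d → Vec n → Vec d) (γ : Vec d → Vec n → ℝ)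
    (φ : C12 d) (α : Vec m) (t : ℝ) (x : Vec d) : ℝ :=
  ∫ e, (φ.toFun t (x + η α x e) - φ.toFun t x) * γ x e ∂ν

/-- The local operator `A^α`. -/
def Aop (b : Vec m → Vec d → Vec d) (σ : Vec m → Vec d → Matrix (Fin d) (Fin d) ℝ)
    (φ : C12 d) (α : Vec m) (t : ℝ) (x : Vec d) : ℝ :=
  (1/2) * Matrix.trace (σ α x * (σ α x)ᵀ * φ.hess t x) + ⟪b α x, φ.grad t x⟫

/-- `L^α = A^α + K^α`. -/
def Lop (ν : Measure (Vec n)) (b : Vec m → Vec d → Vec d)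
    (σ : Vec m → Vec d → Matrix (Fin d) (Fin d) ℝ) (η : Vec m → Vec d → Vec n → Vec d)
    (φ : C12 d) (α : Vec m) (t : ℝ) (x : Vec d) : ℝ :=
  Aop b σ φ α t x + Kop ν η φ α t x

/-- Modified diffusion matrix `σ̃`. -/
def sigmaTilde (ν : Measure (Vec n)) (σ : Vec m → Vec d → Matrix (Fin d) (Fin d) ℝ)
    (η : Vec m → Vec d → Vec n → Vec d) (ε : ℝ) (α : Vec m) (x : Vec d) :
    Matrix (Fin d) (Fin d) ℝ :=
  Matrix.of fun i j =>
    if i = j then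
      Real.sqrt ((σ α x i i) ^ 2 + ∫ e in {e : Vec n | ‖e‖ < ε}, (η α x e i) ^ 2 ∂ν)
    else σ α x i j

/-- Truncated `K_ε^α`. -/
def Ktr (ν : Measure (Vec n)) (η : Vec m → Vec d → Vec n → Vec d) (ε : ℝ)
    (φ : C12 d) (α : Vec m) (t : ℝ) (x : Vec d) : ℝ :=
  Kop (ν.restrict {e : Vec n | ε < ‖e‖}) η φ α t x

/-- Truncated `B_ε^α`. -/
def Btr (ν : Measure (Vec n)) (η : Vec m → Vec d → Vec n → Vec d) (γ : Vec d → Vec n → ℝ)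
    (ε : ℝ) (φ : C12 d) (α : Vec m) (t : ℝ) (x : Vec d) : ℝ :=
  Bop (ν.restrict {e : Vec n | ε < ‖e‖}) η γ φ α t x

/-- Truncated `L_ε^α`. -/
def Ltr (ν : Measure (Vec n)) (b : Vec m → Vec d → Vec d)
    (σ : Vec m → Vec d → Matrix (Fin d) (Fin d) ℝ) (η : Vec m → Vec d → Vec n → Vec d)
    (ε : ℝ) (φ : C12 d) (α : Vec m) (t : ℝ) (x : Vec d) : ℝ :=
  (1/2) * Matrix.trace (sigmaTilde ν σ η ε α x * (sigmaTilde ν σ η ε α x)ᵀ * φ.hess t x)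
    + ⟪b α x, φ.grad t x⟫ + Ktr ν η ε φ α t x

/-- Viscosity subsolution of the HJBVI
`min{ u − ζ, ∂ₜu + inf_{α∈A}( −L^α u − f(α,t,x,u,σᵀDu,B^α u) ) } = 0`. -/
def SubsolnHJBVI (ν : Measure (Vec n)) (A : Set (Vec m)) (T : ℝ)
    (b : Vec m → Vec d → Vec d) (σ : Vec m → Vec d → Matrix (Fin d) (Fin d) ℝ)
    (η : Vec m → Vec d → Vec n → Vec d) (γ : Vec d → Vec n → ℝ)
    (f : Vec m → ℝ → Vec d → ℝ → Vec d → ℝ → ℝ) (ζ : ℝ → Vec d → ℝ)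
    (u : ℝ → Vec d → ℝ) : Prop :=
  ∀ (φ : C12 d) (t₀ : ℝ) (x₀ : Vec d), t₀ ∈ Ioc (0:ℝ) T →
    (∀ t ∈ Icc (0:ℝ) T, ∀ x, u t x - φ.toFun t x ≤ u t₀ x₀ - φ.toFun t₀ x₀) →
    min (u t₀ x₀ - ζ t₀ x₀)
      (φ.dt t₀ x₀ + ⨅ α : A, (-(Lop ν b σ η φ (↑α) t₀ x₀)
        - f (↑α) t₀ x₀ (u t₀ x₀) (mvE ((σ (↑α) x₀)ᵀ) (φ.grad t₀ x₀))
            (Bop ν η γ φ (↑α) t₀ x₀))) ≤ 0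

/-- Viscosity supersolution of the HJBVI. -/
def SupersolnHJBVI (ν : Measure (Vec n)) (A : Set (Vec m)) (T : ℝ)
    (b : Vec m → Vec d → Vec d) (σ : Vec m → Vec d → Matrix (Fin d) (Fin d) ℝ)
    (η : Vec m → Vec d → Vec n → Vec d) (γ : Vec d → Vec n → ℝ)
    (f : Vec m → ℝ → Vec d → ℝ → Vec d → ℝ → ℝ) (ζ : ℝ → Vec d → ℝ)
    (u : ℝ → Vec d → ℝ) : Prop :=
  ∀ (φ : C12 d) (t₀ : ℝ) (x₀ : Vec d), t₀ ∈ Ioc (0:ℝ) T →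
    (∀ t ∈ Icc (0:ℝ) T, ∀ x, u t₀ x₀ - φ.toFun t₀ x₀ ≤ u t x - φ.toFun t x) →
    0 ≤ min (u t₀ x₀ - ζ t₀ x₀)
      (φ.dt t₀ x₀ + ⨅ α : A, (-(Lop ν b σ η φ (↑α) t₀ x₀)
        - f (↑α) t₀ x₀ (u t₀ x₀) (mvE ((σ (↑α) x₀)ᵀ) (φ.grad t₀ x₀))
            (Bop ν η γ φ (↑α) t₀ x₀)))

/-- Viscosity subsolution of the `A'`-HJBVI with `ε`-truncated operators. -/
def SubsolnHJBVIe (ν : Measure (Vec n)) (A' : Set (Vec m)) (T : ℝ)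
    (b : Vec m → Vec d → Vec d) (σ : Vec m → Vec d → Matrix (Fin d) (Fin d) ℝ)
    (η : Vec m → Vec d → Vec n → Vec d) (γ : Vec d → Vec n → ℝ)
    (f : Vec m → ℝ → Vec d → ℝ → Vec d → ℝ → ℝ) (ζ : ℝ → Vec d → ℝ) (ε : ℝ)
    (u : ℝ → Vec d → ℝ) : Prop :=
  ∀ (φ : C12 d) (t₀ : ℝ) (x₀ : Vec d), t₀ ∈ Ioc (0:ℝ) T →
    (∀ t ∈ Icc (0:ℝ) T, ∀ x, u t x - φ.toFun t x ≤ u t₀ x₀ - φ.toFun t₀ x₀) →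
    min (u t₀ x₀ - ζ t₀ x₀)
      (φ.dt t₀ x₀ + ⨅ α : A', (-(Ltr ν b σ η ε φ (↑α) t₀ x₀)
        - f (↑α) t₀ x₀ (u t₀ x₀) (mvE ((sigmaTilde ν σ η ε (↑α) x₀)ᵀ) (φ.grad t₀ x₀))
            (Btr ν η γ ε φ (↑α) t₀ x₀))) ≤ 0

/-- Viscosity supersolution of the `A'`-HJBVI with `ε`-truncated operators. -/
def SupersolnHJBVIe (ν : Measure (Vec n)) (A' : Set (Vec m)) (T : ℝ)
    (b : Vec m → Vec d → Vec d) (σ : Vec m → Vec d → Matrix (Fin d) (Fin d) ℝ)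
    (η : Vec m → Vec d → Vec n → Vec d) (γ : Vec d → Vec n → ℝ)
    (f : Vec m → ℝ → Vec d → ℝ → Vec d → ℝ → ℝ) (ζ : ℝ → Vec d → ℝ) (ε : ℝ)
    (u : ℝ → Vec d → ℝ) : Prop :=
  ∀ (φ : C12 d) (t₀ : ℝ) (x₀ : Vec d), t₀ ∈ Ioc (0:ℝ) T →
    (∀ t ∈ Icc (0:ℝ) T, ∀ x, u t₀ x₀ - φ.toFun t₀ x₀ ≤ u t x - φ.toFun t x) →
    0 ≤ min (u t₀ x₀ - ζ t₀ x₀)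
      (φ.dt t₀ x₀ + ⨅ α : A', (-(Ltr ν b σ η ε φ (↑α) t₀ x₀)
        - f (↑α) t₀ x₀ (u t₀ x₀) (mvE ((sigmaTilde ν σ η ε (↑α) x₀)ᵀ) (φ.grad t₀ x₀))
            (Btr ν η γ ε φ (↑α) t₀ x₀)))

/-- The switching obstacle `M_j U = max_{k ≠ j} (U_k − c)`. -/
def MaxSw {J : ℕ} (U : Fin J → ℝ → Vec d → ℝ) (c : ℝ) (j : Fin J) (t : ℝ) (x : Vec d) : ℝ :=
  ⨆ k : {k : Fin J // k ≠ j}, (U (↑k) t x - c)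

/-- Viscosity subsolution of the switching system. -/
def SubsolnSwitch (ν : Measure (Vec n)) (T : ℝ)
    (b : Vec m → Vec d → Vec d) (σ : Vec m → Vec d → Matrix (Fin d) (Fin d) ℝ)
    (η : Vec m → Vec d → Vec n → Vec d) (γ : Vec d → Vec n → ℝ)
    (f : Vec m → ℝ → Vec d → ℝ → Vec d → ℝ → ℝ) (ζ : ℝ → Vec d → ℝ) (ε : ℝ)
    {J : ℕ} (αs : Fin J → Vec m) (c : ℝ) (U : Fin J → ℝ → Vec d → ℝ) : Prop :=
  ∀ (j : Fin J) (φ : C12 d) (t₀ : ℝ) (x₀ : Vec d), t₀ ∈ Ioc (0:ℝ) T →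
    (∀ t ∈ Icc (0:ℝ) T, ∀ x, U j t x - φ.toFun t x ≤ U j t₀ x₀ - φ.toFun t₀ x₀) →
    min (U j t₀ x₀ - ζ t₀ x₀)
      (min (φ.dt t₀ x₀ - Ltr ν b σ η ε φ (αs j) t₀ x₀
          - f (αs j) t₀ x₀ (U j t₀ x₀)
              (mvE ((sigmaTilde ν σ η ε (αs j) x₀)ᵀ) (φ.grad t₀ x₀))
              (Btr ν η γ ε φ (αs j) t₀ x₀))
        (U j t₀ x₀ - MaxSw U c j t₀ x₀)) ≤ 0

/-- Viscosity supersolution of the switching system. -/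
def SupersolnSwitch (ν : Measure (Vec n)) (T : ℝ)
    (b : Vec m → Vec d → Vec d) (σ : Vec m → Vec d → Matrix (Fin d) (Fin d) ℝ)
    (η : Vec m → Vec d → Vec n → Vec d) (γ : Vec d → Vec n → ℝ)
    (f : Vec m → ℝ → Vec d → ℝ → Vec d → ℝ → ℝ) (ζ : ℝ → Vec d → ℝ) (ε : ℝ)
    {J : ℕ} (αs : Fin J → Vec m) (c : ℝ) (U : Fin J → ℝ → Vec d → ℝ) : Prop :=
  ∀ (j : Fin J) (φ : C12 d) (t₀ : ℝ) (x₀ : Vec d), t₀ ∈ Ioc (0:ℝ) T →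
    (∀ t ∈ Icc (0:ℝ) T, ∀ x, U j t₀ x₀ - φ.toFun t₀ x₀ ≤ U j t x - φ.toFun t x) →
    0 ≤ min (U j t₀ x₀ - ζ t₀ x₀)
      (min (φ.dt t₀ x₀ - Ltr ν b σ η ε φ (αs j) t₀ x₀
          - f (αs j) t₀ x₀ (U j t₀ x₀)
              (mvE ((sigmaTilde ν σ η ε (αs j) x₀)ᵀ) (φ.grad t₀ x₀))
              (Btr ν η γ ε φ (αs j) t₀ x₀))
        (U j t₀ x₀ - MaxSw U c j t₀ x₀))

/-! ### Spatial grid, monotone discretization and Lax–Friedrichs flux -/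

/-- The grid point `x_m = h·m` of the uniform grid `hℤ^d`. -/
def gridPt (d : ℕ) (h : ℝ) (mm : Fin d → ℤ) : Vec d :=
  (EuclideanSpace.equiv (Fin d) ℝ).symm fun l => h * (mm l : ℝ)

/-- The multilinear tent function `ω_m(x;h)`. -/
def tent (d : ℕ) (h : ℝ) (mm : Fin d → ℤ) (x : Vec d) : ℝ :=
  ∏ l : Fin d, max 0 (1 - |x l / h - (mm l : ℝ)|)

/-- The interpolant `I_h[φ]`. -/
def interp (d : ℕ) (h : ℝ) (φ : Vec d → ℝ) (x : Vec d) : ℝ :=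
  ∑' mm : Fin d → ℤ, φ (gridPt d h mm) * tent d h mm x

/-- Coefficient `κ_{h,m,i}`. -/
def kapC {n d m : ℕ} (ν : Measure (Vec n)) (η : Vec m → Vec d → Vec n → Vec d)
    (ε h : ℝ) (α : Vec m) (mm i : Fin d → ℤ) : ℝ :=
  ∫ e in {e : Vec n | ε < ‖e‖}, tent d h mm (η α (gridPt d h i) e) ∂ν

/-- Coefficient `β_{h,m,i}`. -/
def betC {n d m : ℕ} (ν : Measure (Vec n)) (η : Vec m → Vec d → Vec n → Vec d)
    (γ : Vec d → Vec n → ℝ) (ε h : ℝ) (α : Vec m) (mm i : Fin d → ℤ) : ℝ :=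
  ∫ e in {e : Vec n | ε < ‖e‖}, tent d h mm (η α (gridPt d h i) e) * γ (gridPt d h i) e ∂ν

/-- The drift correction `b_ε(α,x) = −∫_{|e|>ε} η(α,x,e) ν(de)`. -/
def bTrunc {n d m : ℕ} (ν : Measure (Vec n)) (η : Vec m → Vec d → Vec n → Vec d)
    (ε : ℝ) (α : Vec m) (x : Vec d) : Vec d :=
  -(∫ e in {e : Vec n | ε < ‖e‖}, η α x e ∂ν)

/-- The modified drift `b̃ = b + b_ε`. -/
def bMod {n d m : ℕ} (ν : Measure (Vec n)) (b : Vec m → Vec d → Vec d)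
    (η : Vec m → Vec d → Vec n → Vec d) (ε : ℝ) (α : Vec m) (x : Vec d) : Vec d :=
  b α x + bTrunc ν η ε α x

/-- The `l`-th column of a matrix, as a vector. -/
def col {d : ℕ} (M : Matrix (Fin d) (Fin d) ℝ) (l : Fin d) : Vec d :=
  (EuclideanSpace.equiv (Fin d) ℝ).symm fun r => M r l

/-- Coefficient `d_{h,k,m,i}` of the semi-Lagrangian discretization. -/
def dC {n d m : ℕ} (ν : Measure (Vec n)) (b : Vec m → Vec d → Vec d)
    (σ : Vec m → Vec d → Matrix (Fin d) (Fin d) ℝ) (η : Vec m → Vec d → Vec n → Vec d)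
    (ε h k : ℝ) (α : Vec m) (mm i : Fin d → ℤ) : ℝ :=
  (1 / (2 * k ^ 2)) * ∑ l : Fin d,
      (tent d h mm (gridPt d h i + k • col (sigmaTilde ν σ η ε α (gridPt d h i)) l)
        + tent d h mm (gridPt d h i - k • col (sigmaTilde ν σ η ε α (gridPt d h i)) l))
    + (1 / k ^ 2) * tent d h mm (gridPt d h i + (k ^ 2) • bMod ν b η ε α (gridPt d h i))

/-- The discrete local operator `A_{ε,h,k}`. -/
def Adisc {n d m : ℕ} (ν : Measure (Vec n)) (b : Vec m → Vec d → Vec d)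
    (σ : Vec m → Vec d → Matrix (Fin d) (Fin d) ℝ) (η : Vec m → Vec d → Vec n → Vec d)
    (ε h k : ℝ) (α : Vec m) (U : (Fin d → ℤ) → ℝ) (i : Fin d → ℤ) : ℝ :=
  ∑' mm : Fin d → ℤ, dC ν b σ η ε h k α mm i * (U mm - U i)

/-- The discrete nonlocal operator `K¹_{ε,h}`. -/
def Kdisc {n d m : ℕ} (ν : Measure (Vec n)) (η : Vec m → Vec d → Vec n → Vec d)
    (ε h : ℝ) (α : Vec m) (U : (Fin d → ℤ) → ℝ) (i : Fin d → ℤ) : ℝ :=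
  ∑' mm : {mm : Fin d → ℤ // mm ≠ 0}, kapC ν η ε h α (↑mm) i * (U (i + ↑mm) - U i)

/-- The discrete nonlocal operator `B_{ε,h}`. -/
def Bdisc {n d m : ℕ} (ν : Measure (Vec n)) (η : Vec m → Vec d → Vec n → Vec d)
    (γ : Vec d → Vec n → ℝ) (ε h : ℝ) (α : Vec m) (U : (Fin d → ℤ) → ℝ)
    (i : Fin d → ℤ) : ℝ :=
  ∑' mm : {mm : Fin d → ℤ // mm ≠ 0}, betC ν η γ ε h α (↑mm) i * (U (i + ↑mm) - U i)

/-- The `l`-th coordinate unit vector of `ℤ^d`. -/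
def unitZ (d : ℕ) (l : Fin d) : Fin d → ℤ := fun r => if r = l then 1 else 0

/-- Forward difference `Δ₊^{(l)}U_i`. -/
def dPlus {d : ℕ} (U : (Fin d → ℤ) → ℝ) (l : Fin d) (i : Fin d → ℤ) : ℝ :=
  U (i + unitZ d l) - U i

/-- Backward difference `Δ₋^{(l)}U_i`. -/
def dMinus {d : ℕ} (U : (Fin d → ℤ) → ℝ) (l : Fin d) (i : Fin d → ℤ) : ℝ :=
  U i - U (i - unitZ d l)

/-- Central difference vector `ΔU_i`. -/
def dCent {d : ℕ} (U : (Fin d → ℤ) → ℝ) (i : Fin d → ℤ) : Vec d :=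
  (EuclideanSpace.equiv (Fin d) ℝ).symm fun l => dPlus U l i + dMinus U l i

/-- The Lax–Friedrichs numerical flux `f̃`. -/
def LFflux {d : ℕ} (fbar : Vec d → ℝ → Vec d → ℝ → ℝ) (h Δt θ : ℝ)
    (U : (Fin d → ℤ) → ℝ) (i : Fin d → ℤ) (u k : ℝ) : ℝ :=
  fbar (gridPt d h i) u ((1 / (2 * h)) • dCent U i) k
    + (θ / (Δt / h)) * ∑ l : Fin d, (dPlus U l i - dMinus U l i) / h

/-- Bounded grid functions. -/
def IsBddG {d : ℕ} (U : (Fin d → ℤ) → ℝ) : Prop := ∃ M, ∀ i, |U i| ≤ M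

/-- The implicit scheme step equation (4.12)/(3.12): for every grid index `i`,
`U_i − Δt(A_{ε,h,k}U_i + K¹_{ε,h}U_i + f̃(x_i,U_i,ΔU_i,B_{ε,h}U_i)) = G_i`. -/
def ImplicitStep {n d m : ℕ} (ν : Measure (Vec n)) (b : Vec m → Vec d → Vec d)
    (σ : Vec m → Vec d → Matrix (Fin d) (Fin d) ℝ) (η : Vec m → Vec d → Vec n → Vec d)
    (γ : Vec d → Vec n → ℝ) (f : Vec m → ℝ → Vec d → ℝ → Vec d → ℝ → ℝ)
    (ε : ℝ) (α : Vec m) (t h k Δt θ : ℝ) (G U : (Fin d → ℤ) → ℝ) : Prop :=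
  ∀ i, U i - Δt * (Adisc ν b σ η ε h k α U i + Kdisc ν η ε h α U i
      + LFflux (fun x u p kk => f α t x u (mvE ((sigmaTilde ν σ η ε α x)ᵀ) p) kk)
          h Δt θ U i (U i) (Bdisc ν η γ ε h α U i)) = G i

/-- The constant `C_p = C(1 + sup_{α∈A,x} ‖σ̃(α,x)‖)`. -/
def CpConst {n d m : ℕ} (ν : Measure (Vec n)) (A : Set (Vec m))
    (σ : Vec m → Vec d → Matrix (Fin d) (Fin d) ℝ)
    (η : Vec m → Vec d → Vec n → Vec d) (ε C : ℝ) : ℝ :=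
  C * (1 + sSup ((fun p : Vec m × Vec d => ‖sigmaTilde ν σ η ε p.1 p.2‖) '' (A ×ˢ univ)))

theorem hat_sum_floor (s : ℝ) (g : ℤ → ℝ) :
    ∑ j ∈ ({⌊s⌋, ⌊s⌋ + 1} : Finset ℤ), max 0 (1 - |s - (j : ℝ)|) * g j
      = (1 - Int.fract s) * g ⌊s⌋ + Int.fract s * g (⌊s⌋ + 1) := by
  have h0 := Int.fract_nonneg s
  have h1 := Int.fract_lt_one s
  have hf : s - (⌊s⌋ : ℝ) = Int.fract s := rfl
  rw [Finset.sum_pair (by omega)]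
  have h2 : s - ((⌊s⌋ + 1 : ℤ) : ℝ) = -(1 - Int.fract s) := by push_cast; linarith
  rw [hf, h2, abs_neg, abs_of_nonneg h0, abs_of_nonneg (by linarith : 0 ≤ 1 - Int.fract s),
    max_eq_right (by linarith), max_eq_right (by linarith)]
  ring

/-- The vertices of the grid cell containing `x`. -/
def cellVertices (d : ℕ) (h : ℝ) (x : Vec d) : Finset (Fin d → ℤ) :=
  Fintype.piFinset fun l => {⌊x l / h⌋, ⌊x l / h⌋ + 1}

theorem tent_nonneg (h : ℝ) (mm : Fin d → ℤ) (x : Vec d) : 0 ≤ tent d h mm x :=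
  Finset.prod_nonneg fun _ _ => le_max_left _ _

theorem tent_le_one (h : ℝ) (mm : Fin d → ℤ) (x : Vec d) : tent d h mm x ≤ 1 :=
  Finset.prod_le_one (fun _ _ => le_max_left _ _) fun l _ =>
    max_le zero_le_one (by linarith [abs_nonneg (x l / h - (mm l : ℝ))])

theorem measurable_tent (h : ℝ) (mm : Fin d → ℤ) : Measurable (tent d h mm) := by
  unfold tent
  fun_prop

theorem abs_sub_lt_one_of_tent_ne_zero {h : ℝ} {mm : Fin d → ℤ} {x : Vec d}
    (hne : tent d h mm x ≠ 0) (l : Fin d) : |x l / h - (mm l : ℝ)| < 1 := by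
  by_contra hl
  exact hne (Finset.prod_eq_zero (Finset.mem_univ l) (max_eq_left (by linarith [not_lt.1 hl])))

theorem mem_cellVertices_of_tent_ne_zero {h : ℝ} {mm : Fin d → ℤ} {x : Vec d}
    (hne : tent d h mm x ≠ 0) : mm ∈ cellVertices d h x := by
  refine Fintype.mem_piFinset.2 fun l => ?_
  have h1 := abs_lt.1 (abs_sub_lt_one_of_tent_ne_zero hne l)
  have h2 : ⌊x l / h⌋ < mm l + 1 := Int.floor_lt.2 (by push_cast; linarith)
  have h3 : mm l - 1 ≤ ⌊x l / h⌋ := Int.le_floor.2 (by push_cast; linarith)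
  simp only [Finset.mem_insert, Finset.mem_singleton]
  omega

theorem sum_cellVertices_prod (h : ℝ) (x : Vec d) (g : Fin d → ℤ → ℝ) :
    ∑ mm ∈ cellVertices d h x, tent d h mm x * ∏ l, g l (mm l)
      = ∏ l, ((1 - Int.fract (x l / h)) * g l ⌊x l / h⌋
          + Int.fract (x l / h) * g l (⌊x l / h⌋ + 1)) := by
  simp_rw [← hat_sum_floor, Finset.prod_univ_sum, tent, ← Finset.prod_mul_distrib]
  rfl

theorem sum_cellVertices_tent (h : ℝ) (x : Vec d) :
    ∑ mm ∈ cellVertices d h x, tent d h mm x = 1 := by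
  simpa using sum_cellVertices_prod h x fun _ _ => 1

theorem sum_cellVertices_tent_mul_coord {h : ℝ} (hh : 0 < h) (x : Vec d) (r : Fin d) :
    ∑ mm ∈ cellVertices d h x, tent d h mm x * (h * (mm r : ℝ)) = x r := by
  have key := sum_cellVertices_prod h x fun l j => if l = r then h * (j : ℝ) else 1
  simp only [Finset.prod_ite_eq', Finset.mem_univ, if_true] at key
  rw [key, Finset.prod_eq_single r]
  · have h1 : (⌊x r / h⌋ : ℝ) + Int.fract (x r / h) = x r / h := Int.floor_add_fract _
    simp only [if_true]
    push_cast
    calc _ = h * ((⌊x r / h⌋ : ℝ) + Int.fract (x r / h)) := by ring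
      _ = x r := by rw [h1]; field_simp
  · intro l _ hl
    simp [hl]
  · simp

theorem gridPt_apply (h : ℝ) (mm : Fin d → ℤ) (l : Fin d) : gridPt d h mm l = h * (mm l : ℝ) := rfl

theorem gridPt_add (h : ℝ) (i mm : Fin d → ℤ) :
    gridPt d h (i + mm) = gridPt d h i + gridPt d h mm := by
  ext l
  simp [gridPt_apply, mul_add]

theorem gridPt_zero (h : ℝ) : gridPt d h 0 = 0 := by
  ext l
  simp [gridPt_apply]

theorem sum_cellVertices_tent_smul_gridPt {h : ℝ} (hh : 0 < h) (x : Vec d) :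
    ∑ mm ∈ cellVertices d h x, tent d h mm x • gridPt d h mm = x := by
  ext r
  simpa [gridPt_apply] using sum_cellVertices_tent_mul_coord hh x r

theorem norm_gridPt_sub_sq_le {h : ℝ} (hh : 0 < h) {mm : Fin d → ℤ} {x : Vec d}
    (hne : tent d h mm x ≠ 0) : ‖gridPt d h mm - x‖ ^ 2 ≤ d * h ^ 2 := by
  rw [EuclideanSpace.norm_sq_eq]
  calc _ ≤ ∑ _l : Fin d, h ^ 2 := by
        refine Finset.sum_le_sum fun l _ => ?_
        have h1 := abs_sub_lt_one_of_tent_ne_zero hne l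
        have h2 : (gridPt d h mm - x) l = -(h * (x l / h - (mm l : ℝ))) := by
          simp only [PiLp.sub_apply, gridPt_apply]
          field_simp
          ring
        rw [h2, norm_neg, Real.norm_eq_abs, abs_mul, abs_of_pos hh, mul_pow]
        have h3 : |x l / h - (mm l : ℝ)| ^ 2 ≤ 1 := pow_le_one₀ (abs_nonneg _) h1.le
        nlinarith [sq_nonneg h]
    _ = d * h ^ 2 := by simp

/-- Multilinear interpolation is second-order accurate for functions with a quadratic
Taylor bound. -/
theorem abs_sum_tent_sub_le {h : ℝ} (hh : 0 < h) (x : Vec d) (ψ : Vec d → ℝ) (c M : ℝ) (G : Vec d)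
    (hM : 0 ≤ M) (hT : ∀ z, |ψ z - ψ x - ⟪G, z - x⟫| ≤ M * ‖z - x‖ ^ 2) :
    |∑ mm ∈ cellVertices d h x, tent d h mm x * (ψ (gridPt d h mm) - c) - (ψ x - c)|
      ≤ M * (d * h ^ 2) := by
  have h1 := sum_cellVertices_tent h x
  have h2 : ∑ mm ∈ cellVertices d h x, tent d h mm x * ⟪G, gridPt d h mm - x⟫ = 0 := by
    have : ∑ mm ∈ cellVertices d h x, tent d h mm x • (gridPt d h mm - x) = 0 := by
      simp_rw [smul_sub, Finset.sum_sub_distrib, ← Finset.sum_smul]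
      rw [h1, one_smul, sum_cellVertices_tent_smul_gridPt hh, sub_self]
    calc _ = ⟪G, ∑ mm ∈ cellVertices d h x, tent d h mm x • (gridPt d h mm - x)⟫ := by
          simp_rw [inner_sum, real_inner_smul_right]
      _ = 0 := by rw [this, inner_zero_right]
  have h3 : ∑ mm ∈ cellVertices d h x, tent d h mm x * (ψ (gridPt d h mm) - c) - (ψ x - c)
      = ∑ mm ∈ cellVertices d h x,
          tent d h mm x * (ψ (gridPt d h mm) - ψ x - ⟪G, gridPt d h mm - x⟫) := by
    have h4 : ∀ mm, tent d h mm x * (ψ (gridPt d h mm) - ψ x - ⟪G, gridPt d h mm - x⟫)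
        = tent d h mm x * (ψ (gridPt d h mm) - c) - tent d h mm x * (ψ x - c)
          - tent d h mm x * ⟪G, gridPt d h mm - x⟫ := fun mm => by ring
    simp_rw [h4, Finset.sum_sub_distrib]
    rw [h2, ← Finset.sum_mul, h1]
    ring
  rw [h3]
  calc _ ≤ ∑ mm ∈ cellVertices d h x,
          |tent d h mm x * (ψ (gridPt d h mm) - ψ x - ⟪G, gridPt d h mm - x⟫)| :=
        Finset.abs_sum_le_sum_abs _ _
    _ ≤ ∑ mm ∈ cellVertices d h x, tent d h mm x * (M * (d * h ^ 2)) := by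
        refine Finset.sum_le_sum fun mm _ => ?_
        by_cases hne : tent d h mm x = 0
        · simp [hne]
        rw [abs_mul, abs_of_nonneg (tent_nonneg _ _ _)]
        exact mul_le_mul_of_nonneg_left
          ((hT _).trans (mul_le_mul_of_nonneg_left (norm_gridPt_sub_sq_le hh hne) hM))
          (tent_nonneg _ _ _)
    _ = M * (d * h ^ 2) := by rw [← Finset.sum_mul, h1, one_mul]

theorem hasSum_tent_mul (h : ℝ) (x : Vec d) (u : (Fin d → ℤ) → ℝ) :
    HasSum (fun mm => tent d h mm x * u mm)
      (∑ mm ∈ cellVertices d h x, tent d h mm x * u mm) :=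
  hasSum_sum_of_ne_finset_zero fun mm hmm => by
    rw [not_imp_comm.1 mem_cellVertices_of_tent_ne_zero hmm, zero_mul]

/-- Consistency of the interpolation quadrature for an integral operator. -/
theorem abs_tsum_integral_tent_sub_le {h : ℝ} (hh : 0 < h) (μ : Measure (Vec n))
    (Y : Vec n → Vec d) (hY : Measurable Y) {R : ℝ} (hR : ∀ e, ‖Y e‖ ≤ R)
    (w : Vec n → ℝ) (hw : Integrable w μ) (hw0 : ∀ e, 0 ≤ w e)
    (ψ : Vec d → ℝ) (G : Vec d → Vec d) {M : ℝ} (hM : 0 ≤ M)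
    (hT : ∀ x z, |ψ z - ψ x - ⟪G x, z - x⟫| ≤ M * ‖z - x‖ ^ 2)
    (hψ : Integrable (fun e => (ψ (Y e) - ψ 0) * w e) μ) :
    |∑' mm : {mm : Fin d → ℤ // mm ≠ 0},
          (∫ e, tent d h (↑mm) (Y e) * w e ∂μ) * (ψ (gridPt d h ↑mm) - ψ 0)
        - ∫ e, (ψ (Y e) - ψ 0) * w e ∂μ| ≤ M * (d * h ^ 2) * ∫ e, w e ∂μ := by
  obtain ⟨N, hN⟩ := exists_nat_gt (R / h + 1)
  let Q : Finset (Fin d → ℤ) := Fintype.piFinset fun _ => Finset.Icc (-(N : ℤ)) N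
  have hQ : ∀ mm ∉ Q, ∀ e, tent d h mm (Y e) = 0 := by
    intro mm hmm e
    by_contra hne
    refine hmm (Fintype.mem_piFinset.2 fun l => ?_)
    have h1 := abs_lt.1 (abs_sub_lt_one_of_tent_ne_zero hne l)
    have h2 : |Y e l / h| ≤ R / h := by
      rw [abs_div, abs_of_pos hh]
      exact div_le_div_of_nonneg_right ((PiLp.norm_apply_le (Y e) l).trans (hR e)) hh.le
    have h3 := abs_le.1 h2
    rw [Finset.mem_Icc]
    constructor
    · have : (-(N : ℤ) : ℝ) ≤ (mm l : ℝ) := by push_cast; linarith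
      exact_mod_cast this
    · have : (mm l : ℝ) ≤ ((N : ℤ) : ℝ) := by push_cast; linarith
      exact_mod_cast this
  have hint : ∀ mm, Integrable (fun e => tent d h mm (Y e) * w e) μ := fun mm =>
    hw.bdd_mul (c := 1) ((measurable_tent h mm).comp hY).aestronglyMeasurable
      (ae_of_all _ fun e => by
        rw [Real.norm_eq_abs, abs_of_nonneg (tent_nonneg _ _ _)]; exact tent_le_one _ _ _)
  have hsum : ∑' mm : {mm : Fin d → ℤ // mm ≠ 0},
        (∫ e, tent d h (↑mm) (Y e) * w e ∂μ) * (ψ (gridPt d h ↑mm) - ψ 0)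
      = ∫ e, ∑ mm ∈ Q, tent d h mm (Y e) * w e * (ψ (gridPt d h mm) - ψ 0) ∂μ := by
    rw [integral_finsetSum _ fun mm _ => (hint mm).mul_const _]
    simp_rw [integral_mul_const]
    rw [← tsum_eq_sum (L := .unconditional _) (s := Q)]
    · refine tsum_subtype_eq_of_support_subset (s := {mm : Fin d → ℤ | mm ≠ 0})
        (f := fun mm => (∫ e, tent d h mm (Y e) * w e ∂μ) * (ψ (gridPt d h mm) - ψ 0)) ?_
      intro mm hmm h0
      subst h0
      simp [gridPt_zero] at hmm
    · intro mm hmm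
      simp [hQ mm hmm]
  have hint' : Integrable
      (fun e => ∑ mm ∈ Q, tent d h mm (Y e) * w e * (ψ (gridPt d h mm) - ψ 0)) μ :=
    integrable_finsetSum _ fun mm _ => (hint mm).mul_const _
  rw [hsum, ← integral_sub hint' hψ, ← integral_const_mul, ← Real.norm_eq_abs]
  refine norm_integral_le_of_norm_le (hw.const_mul _) (ae_of_all _ fun e => ?_)
  have h1 : ∑ mm ∈ Q, tent d h mm (Y e) * w e * (ψ (gridPt d h mm) - ψ 0)
      = (∑ mm ∈ cellVertices d h (Y e), tent d h mm (Y e) * (ψ (gridPt d h mm) - ψ 0)) * w e := by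
    have h2 := hasSum_tent_mul h (Y e) fun mm => ψ (gridPt d h mm) - ψ 0
    have h3 : HasSum (fun mm => tent d h mm (Y e) * (ψ (gridPt d h mm) - ψ 0))
        (∑ mm ∈ Q, tent d h mm (Y e) * (ψ (gridPt d h mm) - ψ 0)) :=
      hasSum_sum_of_ne_finset_zero fun mm hmm => by rw [hQ mm hmm, zero_mul]
    rw [← h3.unique h2, Finset.sum_mul]
    exact Finset.sum_congr rfl fun mm _ => by ring
  rw [h1, ← sub_mul, Real.norm_eq_abs, abs_mul, abs_of_nonneg (hw0 e)]
  exact mul_le_mul_of_nonneg_right (abs_sum_tent_sub_le hh _ ψ _ M (G (Y e)) hM (hT _)) (hw0 e)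

section Taylor

variable {E : Type*} [NormedAddCommGroup E] [InnerProductSpace ℝ E] [CompleteSpace E]
  {u : E → ℝ} {G : E → E} {H : E → E →L[ℝ] E}

theorem abs_sub_sub_inner_le_of_hasGradientAt (hu : ∀ x, HasGradientAt u (G x) x)
    (hG : ∀ x, HasFDerivAt G (H x) x) {M : ℝ} (hH : ∀ x, ‖H x‖ ≤ M) (x z : E) :
    |u z - u x - ⟪G x, z - x⟫| ≤ M * ‖z - x‖ ^ 2 := by
  have hLip : ∀ y, ‖G y - G x‖ ≤ M * ‖y - x‖ := fun y =>
    convex_univ.norm_image_sub_le_of_norm_hasFDerivWithin_le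
      (fun y _ => (hG y).hasFDerivWithinAt) (fun y _ => hH y) (mem_univ x) (mem_univ y)
  have hM : 0 ≤ M := (norm_nonneg _).trans (hH x)
  have key := (convex_segment x z).norm_image_sub_le_of_norm_hasFDerivWithin_le'
    (f := u) (f' := fun y => InnerProductSpace.toDual ℝ E (G y))
    (φ := InnerProductSpace.toDual ℝ E (G x)) (C := M * ‖z - x‖)
    (fun y _ => (hu y).hasFDerivAt.hasFDerivWithinAt)
    (fun y hy => by
      rw [← map_sub, LinearIsometryEquiv.norm_map]
      exact (hLip y).trans (mul_le_mul_of_nonneg_left (norm_sub_le_of_mem_segment hy) hM))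
    (left_mem_segment ℝ x z) (right_mem_segment ℝ x z)
  rw [Real.norm_eq_abs, InnerProductSpace.toDual_apply_apply] at key
  linarith [key]

theorem abs_second_difference_sub_le (hu : ∀ x, HasGradientAt u (G x) x)
    (hG : ∀ x, HasFDerivAt G (H x) x) (x v : E) {δ : ℝ}
    (hδ : ∀ z, dist z x ≤ ‖v‖ → ‖H z - H x‖ ≤ δ) :
    |u (x + v) + u (x - v) - 2 * u x - ⟪H x v, v⟫| ≤ 2 * δ * ‖v‖ ^ 2 := by
  have hδ0 : 0 ≤ δ := (norm_nonneg _).trans (hδ x (by simp))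
  have hder : ∀ s : ℝ, HasDerivAt
      (fun s : ℝ => u (x + s • v) + u (x + s • (-v)) - s ^ 2 * ⟪H x v, v⟫)
      (⟪G (x + s • v), v⟫ + ⟪G (x + s • (-v)), -v⟫ - 2 * s * ⟪H x v, v⟫) s := by
    intro s
    have hl : ∀ y : E, HasDerivAt (fun s : ℝ => u (x + s • y)) ⟪G (x + s • y), y⟫ s := by
      intro y
      have h1 : HasDerivAt (fun s : ℝ => x + s • y) y s := by
        simpa using ((hasDerivAt_id s).smul_const y).const_add x
      have h2 := (hu (x + s • y)).hasFDerivAt.comp_hasDerivAt s h1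
      rw [InnerProductSpace.toDual_apply_apply] at h2
      exact h2
    have h2 : HasDerivAt (fun s : ℝ => s ^ 2 * ⟪H x v, v⟫) (2 * s * ⟪H x v, v⟫) s := by
      simpa using (hasDerivAt_pow 2 s).mul_const ⟪H x v, v⟫
    exact ((hl v).add (hl (-v))).sub h2
  have hbound : ∀ s ∈ Icc (0 : ℝ) 1,
      ‖⟪G (x + s • v), v⟫ + ⟪G (x + s • (-v)), -v⟫ - 2 * s * ⟪H x v, v⟫‖ ≤ 2 * δ * ‖v‖ ^ 2 := by
    intro s hs
    have hmem : ∀ y : E, ‖y‖ = ‖v‖ → x + s • y ∈ closedBall x ‖v‖ := by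
      intro y hy
      rw [mem_closedBall, dist_eq_norm, add_sub_cancel_left, norm_smul, Real.norm_eq_abs,
        abs_of_nonneg hs.1, hy]
      exact mul_le_of_le_one_left (norm_nonneg _) hs.2
    have key := (convex_closedBall x ‖v‖).norm_image_sub_le_of_norm_hasFDerivWithin_le'
      (f := G) (f' := H) (φ := H x) (C := δ)
      (fun y _ => (hG y).hasFDerivWithinAt) (fun y hy => hδ y hy)
      (hmem (-v) (norm_neg v)) (hmem v rfl)
    have h3 : x + s • v - (x + s • (-v)) = (2 * s) • v := by
      rw [smul_neg, mul_smul, two_smul]; abel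
    rw [h3, map_smul, norm_smul, Real.norm_eq_abs, abs_of_nonneg (by linarith [hs.1])] at key
    have h4 : ⟪G (x + s • v), v⟫ + ⟪G (x + s • (-v)), -v⟫ - 2 * s * ⟪H x v, v⟫
        = ⟪G (x + s • v) - G (x + s • (-v)) - (2 * s) • H x v, v⟫ := by
      rw [inner_sub_left, inner_sub_left, inner_neg_right, real_inner_smul_left]; ring
    rw [h4]
    calc _ ≤ _ := norm_inner_le_norm _ _
      _ ≤ (δ * (2 * s * ‖v‖)) * ‖v‖ := mul_le_mul_of_nonneg_right key (norm_nonneg _)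
      _ = s * (2 * δ * ‖v‖ ^ 2) := by ring
      _ ≤ 2 * δ * ‖v‖ ^ 2 := mul_le_of_le_one_left (by positivity) hs.2
  have := norm_image_sub_le_of_norm_deriv_le_segment_01' (f := fun s : ℝ =>
    u (x + s • v) + u (x + s • (-v)) - s ^ 2 * ⟪H x v, v⟫)
    (fun s _ => (hder s).hasDerivWithinAt) fun s hs => hbound s (Ico_subset_Icc_self hs)
  simp only [one_smul, zero_smul, add_zero, Real.norm_eq_abs] at this
  rw [← sub_eq_add_neg] at this
  convert this using 2
  ring

end Taylor

theorem UniformContinuous.exists_modulus {X Y : Type*} [PseudoMetricSpace X]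
    [SeminormedAddCommGroup Y] {F : X → Y} (hF : UniformContinuous F) {M : ℝ}
    (hM : ∀ x, ‖F x‖ ≤ M) :
    ∃ w : ℝ → ℝ, (∀ k, 0 ≤ w k) ∧ Tendsto w (𝓝[>] 0) (𝓝 0) ∧
      ∀ k x y, dist x y ≤ k → ‖F x - F y‖ ≤ w k := by
  let D : ℝ → Set ℝ := fun k => {r | ∃ x y, dist x y ≤ k ∧ ‖F x - F y‖ = r}
  have hbdd : ∀ k, BddAbove (D k) := by
    intro k
    refine ⟨M + M, ?_⟩
    rintro r ⟨x, y, -, rfl⟩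
    exact (norm_sub_le _ _).trans (add_le_add (hM x) (hM y))
  have hnn : ∀ k, 0 ≤ sSup (D k) := fun k =>
    Real.sSup_nonneg (by rintro r ⟨x, y, -, rfl⟩; exact norm_nonneg _)
  refine ⟨fun k => sSup (D k), hnn, ?_, fun k x y hxy => le_csSup (hbdd k) ⟨x, y, hxy, rfl⟩⟩
  rw [Metric.tendsto_nhds]
  intro ε hε
  obtain ⟨δ, hδ, hF'⟩ := Metric.uniformContinuous_iff.1 hF (ε / 2) (half_pos hε)
  filter_upwards [Ioo_mem_nhdsGT hδ] with k hk
  rw [Real.dist_0_eq_abs, abs_of_nonneg (hnn k)]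
  refine lt_of_le_of_lt (Real.sSup_le ?_ (half_pos hε).le) (half_lt_self hε)
  rintro r ⟨x, y, hxy, rfl⟩
  rw [← dist_eq_norm]
  exact (hF' (hxy.trans_lt hk.2)).le

theorem trace_mul_transpose_mul_eq_sum_inner (S H : Matrix (Fin d) (Fin d) ℝ) :
    Matrix.trace (S * Sᵀ * H) = ∑ l, ⟪Matrix.toEuclideanLin H (col S l), col S l⟫ := by
  rw [Matrix.mul_assoc, Matrix.trace_mul_comm, Matrix.mul_assoc]
  refine Finset.sum_congr rfl fun l => ?_
  intro _
  simp [Matrix.mul_apply, PiLp.inner_apply, col, Matrix.mulVec, dotProduct]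

theorem norm_col_sq (S : Matrix (Fin d) (Fin d) ℝ) (l : Fin d) :
    ‖col S l‖ ^ 2 = ∑ r, (S r l) ^ 2 := by
  simp [EuclideanSpace.norm_sq_eq, col]

section LevyTail

variable {ν : Measure (Vec n)} {ε : ℝ}

theorem min_one_norm_le (hε : ε ∈ Ioo (0 : ℝ) 1) {e : Vec n} (he : ε < ‖e‖) :
    min 1 ‖e‖ ≤ 1 / ε * min 1 (‖e‖ ^ 2) := by
  have h0 := hε.1
  rw [div_mul_eq_mul_div, one_mul, le_div_iff₀ h0]
  refine le_min ?_ ?_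
  · nlinarith [min_le_left 1 ‖e‖, hε.2, hε.1]
  · nlinarith [min_le_right 1 ‖e‖]

theorem one_le_div_sq_mul_min (hε : ε ∈ Ioo (0 : ℝ) 1) {e : Vec n} (he : ε < ‖e‖) :
    1 ≤ 1 / ε ^ 2 * min 1 (‖e‖ ^ 2) := by
  have h0 := hε.1
  rw [div_mul_eq_mul_div, one_mul, le_div_iff₀ (by positivity), one_mul]
  exact le_min (pow_le_one₀ h0.le hε.2.le) (pow_le_pow_left₀ h0.le he.le 2)

theorem measurableSet_lt_norm : MeasurableSet {e : Vec n | ε < ‖e‖} :=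
  measurableSet_lt measurable_const measurable_norm

theorem integrableOn_and_norm_integral_le_of_tail {F : Type*} [NormedAddCommGroup F]
    [NormedSpace ℝ F]
    (hν : Integrable (fun e : Vec n => min 1 (‖e‖ ^ 2)) ν) {w : Vec n → F}
    (hw : AEStronglyMeasurable w (ν.restrict {e : Vec n | ε < ‖e‖})) {K : ℝ} (hK : 0 ≤ K)
    (hwK : ∀ e, ε < ‖e‖ → ‖w e‖ ≤ K * min 1 (‖e‖ ^ 2)) :
    Integrable w (ν.restrict {e : Vec n | ε < ‖e‖}) ∧
      ‖∫ e in {e : Vec n | ε < ‖e‖}, w e ∂ν‖ ≤ K * ∫ e, min 1 (‖e‖ ^ 2) ∂ν := by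
  have hae : ∀ᵐ e ∂ν.restrict {e : Vec n | ε < ‖e‖}, ‖w e‖ ≤ K * min 1 (‖e‖ ^ 2) :=
    (ae_restrict_iff' measurableSet_lt_norm).2 (ae_of_all _ hwK)
  have hi := (hν.const_mul K).restrict (s := {e : Vec n | ε < ‖e‖})
  refine ⟨hi.mono' hw hae, (norm_integral_le_of_norm_le hi hae).trans ?_⟩
  rw [← integral_const_mul]
  exact setIntegral_le_integral (hν.const_mul K) (ae_of_all _ fun e => by positivity)

end LevyTail

/-- Consistency of the semi-Lagrangian discretization of the local operator. -/
theorem abs_Adisc_sub_le (ν : Measure (Vec n)) (b : Vec m → Vec d → Vec d)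
    (σ : Vec m → Vec d → Matrix (Fin d) (Fin d) ℝ) (η : Vec m → Vec d → Vec n → Vec d)
    (ε : ℝ) (α : Vec m) {h k : ℝ} (hh : 0 < h) (hk : 0 < k) (i : Fin d → ℤ)
    {u : Vec d → ℝ} {G : Vec d → Vec d} {H : Vec d → Vec d →L[ℝ] Vec d}
    (hu : ∀ x, HasGradientAt u (G x) x) (hG : ∀ x, HasFDerivAt G (H x) x)
    {M R δ : ℝ} (hH : ∀ x, ‖H x‖ ≤ M)
    (hR : ∀ l, ‖col (sigmaTilde ν σ η ε α (gridPt d h i)) l‖ ≤ R)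
    (hδ : ∀ x y, dist x y ≤ k * R → ‖H x - H y‖ ≤ δ) :
    |Adisc ν b σ η ε h k α (fun mm => u (gridPt d h mm)) i
        - ((1 / 2) * ∑ l, ⟪H (gridPt d h i) (col (sigmaTilde ν σ η ε α (gridPt d h i)) l),
              col (sigmaTilde ν σ η ε α (gridPt d h i)) l⟫
          + ⟪bMod ν b η ε α (gridPt d h i), G (gridPt d h i)⟫)|
      ≤ M * d * (d + 1) * (h ^ 2 / k ^ 2) + M * ‖bMod ν b η ε α (gridPt d h i)‖ ^ 2 * k ^ 2
        + d * R ^ 2 * δ := by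
  have hM : 0 ≤ M := (norm_nonneg _).trans (hH 0)
  have hT := abs_sub_sub_inner_le_of_hasGradientAt hu hG hH
  set x := gridPt d h i
  set s := fun l => col (sigmaTilde ν σ η ε α x) l
  set β := bMod ν b η ε α x
  let J : Vec d → ℝ := fun y =>
    ∑ mm ∈ cellVertices d h y, tent d h mm y * (u (gridPt d h mm) - u x)
  have hJs : ∀ y, HasSum (fun mm => tent d h mm y * (u (gridPt d h mm) - u x)) (J y) :=
    fun y => hasSum_tent_mul h y _
  have hJ : ∀ y, |J y - (u y - u x)| ≤ M * (d * h ^ 2) := fun y =>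
    abs_sum_tent_sub_le hh y u (u x) M (G y) hM (hT y)
  have hA : Adisc ν b σ η ε h k α (fun mm => u (gridPt d h mm)) i
      = 1 / (2 * k ^ 2) * ∑ l, (J (x + k • s l) + J (x - k • s l))
        + 1 / k ^ 2 * J (x + k ^ 2 • β) := by
    have h1 := ((hasSum_sum (s := Finset.univ) fun l _ =>
      (hJs (x + k • s l)).add (hJs (x - k • s l))).mul_left (1 / (2 * k ^ 2))).add
      ((hJs (x + k ^ 2 • β)).mul_left (1 / k ^ 2))
    rw [Adisc, ← h1.tsum_eq]
    refine tsum_congr fun mm => ?_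
    simp_rw [← add_mul, ← Finset.sum_mul, ← mul_assoc, ← add_mul]
    rfl
  have hP : ∀ l, |J (x + k • s l) + J (x - k • s l) - k ^ 2 * ⟪H x (s l), s l⟫|
      ≤ 2 * (M * (d * h ^ 2)) + 2 * δ * (k * R) ^ 2 := by
    intro l
    have hn : ‖k • s l‖ ≤ k * R := by
      rw [norm_smul, Real.norm_eq_abs, abs_of_pos hk]
      exact mul_le_mul_of_nonneg_left (hR l) hk.le
    have hδ0 : 0 ≤ δ := (norm_nonneg _).trans
      (hδ x x (by rw [dist_self]; exact (norm_nonneg _).trans hn))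
    have h1 := abs_second_difference_sub_le hu hG x (k • s l) (δ := δ)
      fun z hz => hδ z x (hz.trans hn)
    rw [map_smul, real_inner_smul_left, real_inner_smul_right] at h1
    have h2 : 2 * δ * ‖k • s l‖ ^ 2 ≤ 2 * δ * (k * R) ^ 2 :=
      mul_le_mul_of_nonneg_left (pow_le_pow_left₀ (norm_nonneg _) hn 2) (by positivity)
    have h3 := abs_le.1 (hJ (x + k • s l))
    have h4 := abs_le.1 (hJ (x - k • s l))
    have h5 := abs_le.1 (h1.trans h2)
    rw [abs_le]
    constructor <;> nlinarith
  have hQ : |J (x + k ^ 2 • β) - k ^ 2 * ⟪β, G x⟫|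
      ≤ M * (d * h ^ 2) + M * (k ^ 2 * ‖β‖) ^ 2 := by
    have h1 := hT x (x + k ^ 2 • β)
    rw [add_sub_cancel_left, real_inner_smul_right, real_inner_comm, norm_smul, Real.norm_eq_abs,
      abs_of_pos (pow_pos hk 2)] at h1
    have h2 := abs_le.1 (hJ (x + k ^ 2 • β))
    have h3 := abs_le.1 h1
    rw [abs_le]
    constructor <;> linarith
  have hdiff : Adisc ν b σ η ε h k α (fun mm => u (gridPt d h mm)) i
        - ((1 / 2) * ∑ l, ⟪H x (s l), s l⟫ + ⟪β, G x⟫)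
      = 1 / (2 * k ^ 2) * ∑ l, (J (x + k • s l) + J (x - k • s l) - k ^ 2 * ⟪H x (s l), s l⟫)
        + 1 / k ^ 2 * (J (x + k ^ 2 • β) - k ^ 2 * ⟪β, G x⟫) := by
    rw [hA, Finset.sum_sub_distrib, ← Finset.mul_sum]
    field_simp
    ring
  rw [hdiff]
  have hsum : |∑ l, (J (x + k • s l) + J (x - k • s l) - k ^ 2 * ⟪H x (s l), s l⟫)|
      ≤ d * (2 * (M * (d * h ^ 2)) + 2 * δ * (k * R) ^ 2) := by
    refine (Finset.abs_sum_le_sum_abs _ _).trans ((Finset.sum_le_sum fun l _ => hP l).trans ?_)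
    simp [mul_add]
  refine (abs_add_le _ _).trans ?_
  rw [abs_mul, abs_mul, abs_of_pos (by positivity : 0 < 1 / (2 * k ^ 2)),
    abs_of_pos (by positivity : 0 < 1 / k ^ 2)]
  refine (add_le_add (mul_le_mul_of_nonneg_left hsum (by positivity))
    (mul_le_mul_of_nonneg_left hQ (by positivity))).trans (le_of_eq ?_)
  field_simp
  ring

/-- Consistency of the discretization of a nonlocal operator with truncated Lévy measure. -/
theorem abs_nonlocal_discretization_sub_le {ν : Measure (Vec n)} {ε : ℝ}
    (hν : Integrable (fun e : Vec n => min 1 (‖e‖ ^ 2)) ν)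
    {h : ℝ} (hh : 0 < h) (i : Fin d → ℤ)
    {Y : Vec n → Vec d} (hY : Measurable Y) {R : ℝ} (hR : ∀ e, ‖Y e‖ ≤ R)
    {w : Vec n → ℝ} (hw : Measurable w) (hw0 : ∀ e, 0 ≤ w e) {K : ℝ} (hK : 0 ≤ K)
    (hwK : ∀ e, ε < ‖e‖ → w e ≤ K * min 1 (‖e‖ ^ 2))
    {u : Vec d → ℝ} {G : Vec d → Vec d} {H : Vec d → Vec d →L[ℝ] Vec d}
    (hu : ∀ x, HasGradientAt u (G x) x) (hG : ∀ x, HasFDerivAt G (H x) x)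
    {L M : ℝ} (hL : ∀ x, ‖G x‖ ≤ L) (hH : ∀ x, ‖H x‖ ≤ M) :
    Integrable (fun e => (u (gridPt d h i + Y e) - u (gridPt d h i)) * w e)
        (ν.restrict {e : Vec n | ε < ‖e‖}) ∧
      |∑' mm : {mm : Fin d → ℤ // mm ≠ 0},
          (∫ e in {e : Vec n | ε < ‖e‖}, tent d h (↑mm) (Y e) * w e ∂ν)
            * (u (gridPt d h (i + ↑mm)) - u (gridPt d h i))
        - ∫ e in {e : Vec n | ε < ‖e‖}, (u (gridPt d h i + Y e) - u (gridPt d h i)) * w e ∂ν|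
      ≤ M * (d * h ^ 2) * (K * ∫ e, min 1 (‖e‖ ^ 2) ∂ν) := by
  have hM : 0 ≤ M := (norm_nonneg _).trans (hH 0)
  have hL0 : 0 ≤ L := (norm_nonneg _).trans (hL 0)
  obtain ⟨hwi, hwn⟩ := integrableOn_and_norm_integral_le_of_tail hν
    hw.aestronglyMeasurable hK fun e he => by
      rw [Real.norm_eq_abs, abs_of_nonneg (hw0 e)]; exact hwK e he
  have hcont : Continuous u := continuous_iff_continuousAt.2 fun x => (hu x).continuousAt
  have hLip : ∀ x y, |u y - u x| ≤ L * ‖y - x‖ := fun x y =>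
    convex_univ.norm_image_sub_le_of_norm_hasFDerivWithin_le
      (fun y _ => (hu y).hasFDerivAt.hasFDerivWithinAt)
      (fun y _ => by rw [LinearIsometryEquiv.norm_map]; exact hL y) (mem_univ x) (mem_univ y)
  have hint : Integrable (fun e => (u (gridPt d h i + Y e) - u (gridPt d h i)) * w e)
      (ν.restrict {e : Vec n | ε < ‖e‖}) := by
    refine hwi.bdd_mul (c := L * R)
      ((hcont.measurable.comp (hY.const_add _)).sub_const _).aestronglyMeasurable
      (ae_of_all _ fun e => (hLip _ _).trans ?_)
    rw [add_sub_cancel_left]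
    exact mul_le_mul_of_nonneg_left (hR e) hL0
  refine ⟨hint, ?_⟩
  have hT := abs_sub_sub_inner_le_of_hasGradientAt hu hG hH
  have key := abs_tsum_integral_tent_sub_le hh (ν.restrict {e : Vec n | ε < ‖e‖}) Y hY hR w hwi hw0
    (fun z => u (gridPt d h i + z)) (fun z => G (gridPt d h i + z)) hM
    (fun y z => by simpa using hT (gridPt d h i + y) (gridPt d h i + z))
    (by simpa using hint)
  simp only [add_zero, ← gridPt_add] at key
  exact key.trans (mul_le_mul_of_nonneg_left ((le_abs_self _).trans hwn) (by positivity))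

theorem norm_col_sigmaTilde_le {ν : Measure (Vec n)}
    {σ : Vec m → Vec d → Matrix (Fin d) (Fin d) ℝ} {η : Vec m → Vec d → Vec n → Vec d}
    {α : Vec m} {x : Vec d} {C S : ℝ}
    (hν : Integrable (fun e : Vec n => min 1 (‖e‖ ^ 2)) ν)
    (hη : ∀ e, ‖η α x e‖ ≤ C * min 1 ‖e‖) (hσ : ‖σ α x‖ ≤ S) (ε : ℝ) (l : Fin d) :
    ‖col (sigmaTilde ν σ η ε α x) l‖
      ≤ Real.sqrt (d * (S ^ 2 + C ^ 2 * ∫ e, min 1 (‖e‖ ^ 2) ∂ν)) := by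
  have hν0 : 0 ≤ ∫ e : Vec n, min 1 (‖e‖ ^ 2) ∂ν := integral_nonneg fun e => by positivity
  have hσe : ∀ r j, (σ α x r j) ^ 2 ≤ S ^ 2 := fun r j =>
    sq_le_sq' (by linarith [neg_abs_le (σ α x r j),
      (Matrix.norm_entry_le_entrywise_sup_norm (σ α x) (i := r) (j := j)).trans hσ,
      Real.norm_eq_abs (σ α x r j)])
      ((le_abs_self _).trans ((Matrix.norm_entry_le_entrywise_sup_norm (σ α x)).trans hσ))
  have hηe : ∀ r, ∫ e in {e : Vec n | ‖e‖ < ε}, (η α x e r) ^ 2 ∂ν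
      ≤ C ^ 2 * ∫ e, min 1 (‖e‖ ^ 2) ∂ν := by
    intro r
    rw [← integral_const_mul]
    refine (integral_mono_of_nonneg (ae_of_all _ fun e => sq_nonneg _)
      (hν.const_mul (C ^ 2)).restrict (ae_of_all _ fun e => ?_)).trans
      (setIntegral_le_integral (hν.const_mul _) (ae_of_all _ fun e => by positivity))
    have h1 : |η α x e r| ≤ C * min 1 ‖e‖ := (PiLp.norm_apply_le (η α x e) r).trans (hη e)
    have h2 : (min 1 ‖e‖) ^ 2 ≤ min 1 (‖e‖ ^ 2) :=
      le_min (pow_le_one₀ (by positivity) (min_le_left _ _))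
        (pow_le_pow_left₀ (by positivity) (min_le_right _ _) 2)
    calc (η α x e r) ^ 2 = |η α x e r| ^ 2 := (sq_abs _).symm
      _ ≤ (C * min 1 ‖e‖) ^ 2 := pow_le_pow_left₀ (abs_nonneg _) h1 2
      _ = C ^ 2 * (min 1 ‖e‖) ^ 2 := by ring
      _ ≤ C ^ 2 * min 1 (‖e‖ ^ 2) := mul_le_mul_of_nonneg_left h2 (sq_nonneg _)
  refine Real.le_sqrt_of_sq_le ?_
  rw [norm_col_sq]
  have hent : ∀ r, (sigmaTilde ν σ η ε α x r l) ^ 2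
      ≤ S ^ 2 + C ^ 2 * ∫ e, min 1 (‖e‖ ^ 2) ∂ν := by
    intro r
    rw [sigmaTilde, Matrix.of_apply]
    split_ifs with hrl
    · rw [Real.sq_sqrt (add_nonneg (sq_nonneg _) (integral_nonneg fun e => sq_nonneg _))]
      exact add_le_add (hσe r r) (hηe r)
    · exact (hσe r l).trans (le_add_of_nonneg_right (by positivity))
  exact (Finset.sum_le_sum fun r _ => hent r).trans (by simp [mul_add])

/-- Consistency of the monotone spatial discretization (Lemma 4.2). -/
theorem monotone_discretization_consistency
    {n d m : ℕ} (ν : Measure (Vec n)) (A : Set (Vec m)) (T : ℝ)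
    (b : Vec m → Vec d → Vec d) (σ : Vec m → Vec d → Matrix (Fin d) (Fin d) ℝ)
    (η : Vec m → Vec d → Vec n → Vec d) (γ : Vec d → Vec n → ℝ)
    (f : Vec m → ℝ → Vec d → ℝ → Vec d → ℝ → ℝ)
    (ζ : ℝ → Vec d → ℝ) (g : Vec d → ℝ) (C : ℝ)
    (hA : AssumptionA ν A T b σ η γ f ζ g C)
    (hbσ_bdd : ∃ S, ∀ α' ∈ A, ∀ x : Vec d, ‖b α' x‖ + ‖σ α' x‖ ≤ S)
    (α : Vec m) (hα : α ∈ A) (t : ℝ) (ht : t ∈ Icc (0:ℝ) T)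
    (φ : C12 d)
    (hgrad_bdd : ∃ M, ∀ x, ‖φ.grad t x‖ ≤ M)
    (hhess_bdd : ∃ M, ∀ x, ‖φ.hess t x‖ ≤ M)
    (hhess_uc : UniformContinuous fun x => φ.hess t x) :
    ∃ C' > (0:ℝ), ∃ ω : ℝ → ℝ, (∀ k, 0 ≤ ω k) ∧
      Tendsto ω (nhdsWithin 0 (Ioi (0:ℝ))) (nhds 0) ∧
      ∀ ε ∈ Ioo (0:ℝ) 1, ∀ h k : ℝ, 0 < h → 0 < k → ∀ i : Fin d → ℤ,
        (|Adisc ν b σ η ε h k α (fun mm => φ.toFun t (gridPt d h mm)) i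
            + Kdisc ν η ε h α (fun mm => φ.toFun t (gridPt d h mm)) i
            - Ltr ν b σ η ε φ α t (gridPt d h i)|
          ≤ C' * (h ^ 2 / k ^ 2 + h ^ 2 / ε ^ 2 + k ^ 2 / ε ^ 2 + ω k)) ∧
        (|Bdisc ν η γ ε h α (fun mm => φ.toFun t (gridPt d h mm)) i
            - Btr ν η γ ε φ α t (gridPt d h i)|
          ≤ C' * h ^ 2 / ε) := by
  obtain ⟨S, hS⟩ := hbσ_bdd
  obtain ⟨L, hL⟩ := hgrad_bdd
  obtain ⟨M₀, hM₀⟩ := hhess_bdd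
  have hC := hA.hC
  have hν := hA.hν_int
  have hη := hA.hη_bdd α hα
  let Λ : Matrix (Fin d) (Fin d) ℝ →L[ℝ] (Vec d →L[ℝ] Vec d) :=
    LinearMap.toContinuousLinearMap
      (LinearMap.toContinuousLinearMap.toLinearMap ∘ₗ
        (Matrix.toEuclideanLin (𝕜 := ℝ) (m := Fin d) (n := Fin d)).toLinearMap)
  let H : Vec d → Vec d →L[ℝ] Vec d := fun x => Λ (φ.hess t x)
  have hu := φ.hasGrad t
  have hG : ∀ x, HasFDerivAt (φ.grad t) (H x) x := φ.hasHess t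
  obtain ⟨KΛ, hKΛ, hΛ⟩ := Λ.bound
  set M : ℝ := KΛ * M₀
  have hH : ∀ x, ‖H x‖ ≤ M := fun x =>
    (hΛ _).trans (mul_le_mul_of_nonneg_left (hM₀ x) hKΛ.le)
  have hM : 0 ≤ M := (norm_nonneg _).trans (hH 0)
  have hHuc : UniformContinuous H := Λ.uniformContinuous.comp hhess_uc
  obtain ⟨w, hw0, hwt, hw⟩ := hHuc.exists_modulus hH
  set V : ℝ := ∫ e, min 1 (‖e‖ ^ 2) ∂ν
  have hV : 0 ≤ V := integral_nonneg fun e => by positivity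
  set R : ℝ := Real.sqrt (d * (S ^ 2 + C ^ 2 * V)) + 1
  have hR : 0 < R := by positivity
  have hS0 : 0 ≤ S := (by positivity : 0 ≤ ‖b α 0‖ + ‖σ α 0‖).trans (hS α hα 0)
  have hb : ∀ x, ‖b α x‖ ≤ S := fun x =>
    (le_add_of_nonneg_right (norm_nonneg _)).trans (hS α hα x)
  have hσ : ∀ x, ‖σ α x‖ ≤ S := fun x =>
    (le_add_of_nonneg_left (norm_nonneg _)).trans (hS α hα x)
  have hηC : ∀ x e, ‖η α x e‖ ≤ C := fun x e =>
    (hη x e).trans (mul_le_of_le_one_right hC.le (min_le_left _ _))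
  set c₁ := M * d * (d + 1)
  set c₂ := M * d * V
  set c₃ := M * (S + C * V) ^ 2
  set c₄ := d * R ^ 2
  set c₅ := M * d * C * V
  have hc₁ : 0 ≤ c₁ := by positivity
  have hc₂ : 0 ≤ c₂ := by positivity
  have hc₃ : 0 ≤ c₃ := by positivity
  have hc₄ : 0 ≤ c₄ := by positivity
  have hc₅ : 0 ≤ c₅ := by positivity
  refine ⟨c₁ + c₂ + c₃ + c₄ + c₅ + 1, by positivity, fun k => w (k * R), fun k => hw0 _, ?_, ?_⟩
  · refine hwt.comp (tendsto_nhdsWithin_iff.2 ⟨?_, ?_⟩)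
    · have : Tendsto (fun k : ℝ => k * R) (𝓝 0) (𝓝 (0 * R)) := tendsto_id.mul_const R
      rw [zero_mul] at this
      exact this.mono_left nhdsWithin_le_nhds
    · filter_upwards [self_mem_nhdsWithin] with k hk
      exact mul_pos hk hR
  intro ε hε h k hh hk i
  have hε0 := hε.1
  set x := gridPt d h i
  obtain ⟨hηi, hηn⟩ := integrableOn_and_norm_integral_le_of_tail (ε := ε) hν
    (hA.hη_meas α x).aestronglyMeasurable (K := C * (1 / ε)) (by positivity) fun e he => by
      rw [mul_assoc]
      exact (hη x e).trans (mul_le_mul_of_nonneg_left (min_one_norm_le hε he) hC.le)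
  refine ⟨?_, ?_⟩
  · have hA' := abs_Adisc_sub_le ν b σ η ε α hh hk i hu hG hH
      (fun l => (norm_col_sigmaTilde_le hν (hη _) (hσ _) ε l).trans (le_add_of_nonneg_right one_pos.le))
      (hw (k * R))
    obtain ⟨hKi, hK⟩ := abs_nonlocal_discretization_sub_le (ε := ε) hν hh i (hA.hη_meas α x) (hηC x)
      (w := fun _ => 1) measurable_const (fun _ => zero_le_one) (K := 1 / ε ^ 2) (by positivity)
      (fun e he => one_le_div_sq_mul_min hε he) hu hG hL hH
    simp only [mul_one] at hKi hK
    have hKtr : Ktr ν η ε φ α t x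
        = ∫ e in {e : Vec n | ε < ‖e‖}, (φ.toFun t (x + η α x e) - φ.toFun t x) ∂ν
          + ⟪bTrunc ν η ε α x, φ.grad t x⟫ := by
      rw [Ktr, Kop, integral_sub hKi (hηi.inner_const _), bTrunc, inner_neg_left,
        real_inner_comm, ← integral_inner hηi]
      simp_rw [real_inner_comm]
      ring
    have hβ : ‖bMod ν b η ε α x‖ ≤ (S + C * V) / ε := by
      have h1 : S ≤ S / ε := le_div_self hS0 hε0 hε.2.le
      have h2 : ‖bTrunc ν η ε α x‖ ≤ C * (1 / ε) * V := by
        rw [bTrunc, norm_neg]; exact hηn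
      calc _ ≤ ‖b α x‖ + ‖bTrunc ν η ε α x‖ := norm_add_le _ _
        _ ≤ S / ε + C * (1 / ε) * V := add_le_add ((hb x).trans h1) h2
        _ = (S + C * V) / ε := by ring
    have hβ2 : M * ‖bMod ν b η ε α x‖ ^ 2 * k ^ 2 ≤ c₃ * (k ^ 2 / ε ^ 2) := by
      calc _ ≤ M * ((S + C * V) / ε) ^ 2 * k ^ 2 := by gcongr
        _ = c₃ * (k ^ 2 / ε ^ 2) := by simp only [c₃]; ring
    have hL' : Ltr ν b σ η ε φ α t x
        = (1 / 2) * ∑ l, ⟪H x (col (sigmaTilde ν σ η ε α x) l), col (sigmaTilde ν σ η ε α x) l⟫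
          + ⟪bMod ν b η ε α x, φ.grad t x⟫
          + ∫ e in {e : Vec n | ε < ‖e‖}, (φ.toFun t (x + η α x e) - φ.toFun t x) ∂ν := by
      rw [Ltr, hKtr, trace_mul_transpose_mul_eq_sum_inner, bMod, inner_add_left]
      have : ∀ v, H x v = Matrix.toEuclideanLin (φ.hess t x) v := fun v => rfl
      simp_rw [this]
      ring
    have hK' : |Kdisc ν η ε h α (fun mm => φ.toFun t (gridPt d h mm)) i
        - ∫ e in {e : Vec n | ε < ‖e‖}, (φ.toFun t (x + η α x e) - φ.toFun t x) ∂ν|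
        ≤ c₂ * (h ^ 2 / ε ^ 2) := by
      refine hK.trans (le_of_eq ?_)
      simp only [c₂]; ring
    have ha := abs_le.1 hA'
    have hk' := abs_le.1 hK'
    have e₁ : 0 ≤ h ^ 2 / k ^ 2 := by positivity
    have e₂ : 0 ≤ h ^ 2 / ε ^ 2 := by positivity
    have e₃ : 0 ≤ k ^ 2 / ε ^ 2 := by positivity
    have e₄ := hw0 (k * R)
    have hfin : c₁ * (h ^ 2 / k ^ 2) + c₂ * (h ^ 2 / ε ^ 2) + c₃ * (k ^ 2 / ε ^ 2)
        + c₄ * w (k * R) ≤ (c₁ + c₂ + c₃ + c₄ + c₅ + 1)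
          * (h ^ 2 / k ^ 2 + h ^ 2 / ε ^ 2 + k ^ 2 / ε ^ 2 + w (k * R)) := by
      simp only [mul_add]
      gcongr <;> linarith
    refine le_trans ?_ hfin
    rw [hL', abs_le]
    constructor <;> linarith
  · obtain ⟨-, hB⟩ := abs_nonlocal_discretization_sub_le (ε := ε) hν hh i (hA.hη_meas α x) (hηC x)
      (hA.hγ_meas x) (hA.hγ_nonneg x) (K := C * (1 / ε)) (by positivity)
      (fun e he => by
        rw [mul_assoc]
        exact (hA.hγ_bdd x e).trans (mul_le_mul_of_nonneg_left (min_one_norm_le hε he) hC.le))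
      hu hG hL hH
    refine hB.trans ?_
    calc _ = c₅ * (h ^ 2 / ε) := by simp only [c₅]; ring
      _ ≤ (c₁ + c₂ + c₃ + c₄ + c₅ + 1) * (h ^ 2 / ε) := by gcongr; linarith
      _ = _ := by ring
end
end

section
/- Monotonicity of the Lax–Friedrichs flux: let f̄ : ℝ^d×ℝ×ℝ^d×ℝ → ℝ satisfy |f̄(x,u,p,k) − f̄(x,u,q,k)| ≤ C_p|p−q| for all x,p,q ∈ ℝ^d and u,k ∈ ℝ, and let h, Δt, θ > 0 with λ := Δt/h and θ ≥ C_pλ. If U, V : ℤ^d → ℝ satisfy V_i ≥ U_i for every i ∈ ℤ^d, then for every i ∈ ℤ^d and all u, k ∈ ℝ: Δt f̃(x_i, u, ΔV_i, k) + 2dθ V_i ≥ Δt f̃(x_i, u, ΔU_i, k) + 2dθ U_i. -/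
open Set Filter Topology

noncomputable section

/-- The Euclidean norm is bounded by the `ℓ¹` norm. -/
theorem EuclideanSpace.norm_le_sum_abs {ι : Type*} [Fintype ι] (x : EuclideanSpace ℝ ι) :
    ‖x‖ ≤ ∑ l, |x l| := by
  rw [EuclideanSpace.norm_eq]
  refine Real.sqrt_le_iff.2 ⟨Finset.sum_nonneg fun l _ => abs_nonneg _, ?_⟩
  simpa only [Real.norm_eq_abs] using
    Finset.sum_sq_le_sq_sum_of_nonneg fun l _ => abs_nonneg (x l)

/-- The Lax–Friedrichs update with the central value absorbed: adding `2dθ U_i` to `Δt f̃` leaves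
the neighbouring values with weight `θ`. -/
theorem LFflux_add_center {d : ℕ} (fbar : Vec d → ℝ → Vec d → ℝ → ℝ) {h Δt : ℝ} (θ : ℝ)
    (hh : h ≠ 0) (hΔt : Δt ≠ 0) (U : (Fin d → ℤ) → ℝ) (i : Fin d → ℤ) (u k : ℝ) :
    Δt * LFflux fbar h Δt θ U i u k + 2 * d * θ * U i =
      Δt * fbar (gridPt d h i) u ((1 / (2 * h)) • dCent U i) k
        + θ * ∑ l, (U (i + unitZ d l) + U (i - unitZ d l)) := by
  have hsum : ∑ l, (dPlus U l i - dMinus U l i) =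
      ∑ l, (U (i + unitZ d l) + U (i - unitZ d l)) - 2 * d * U i := by
    calc ∑ l, (dPlus U l i - dMinus U l i)
        = ∑ l, ((U (i + unitZ d l) + U (i - unitZ d l)) - 2 * U i) :=
          Finset.sum_congr rfl fun l _ => by unfold dPlus dMinus; ring
      _ = _ := by
          rw [Finset.sum_sub_distrib, Finset.sum_const, Finset.card_univ, Fintype.card_fin,
            nsmul_eq_mul]
          ring
  rw [LFflux, ← Finset.sum_div, hsum]
  field_simp
  ring

/-- The central differences of ordered grid functions differ by at most the sum of the increments
at the neighbours. -/
theorem norm_dCent_sub_le {d : ℕ} {U V : (Fin d → ℤ) → ℝ} (hUV : ∀ i, U i ≤ V i)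
    (i : Fin d → ℤ) :
    ‖dCent U i - dCent V i‖ ≤
      ∑ l, (V (i + unitZ d l) + V (i - unitZ d l))
        - ∑ l, (U (i + unitZ d l) + U (i - unitZ d l)) := by
  rw [← Finset.sum_sub_distrib]
  refine (EuclideanSpace.norm_le_sum_abs _).trans (Finset.sum_le_sum fun l _ => ?_)
  have hp := hUV (i + unitZ d l)
  have hm := hUV (i - unitZ d l)
  have hl : (dCent U i - dCent V i) l =
      (dPlus U l i + dMinus U l i) - (dPlus V l i + dMinus V l i) := rfl
  rw [hl, abs_le]
  unfold dPlus dMinus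
  constructor <;> linarith

/-- Monotonicity of the Lax–Friedrichs flux. -/
theorem lax_friedrichs_monotone
    {d : ℕ} (Cp : ℝ) (hCp : 0 < Cp)
    (fbar : Vec d → ℝ → Vec d → ℝ → ℝ)
    (hfbar_lip : ∀ (x : Vec d) (u : ℝ) (p q : Vec d) (k : ℝ),
      |fbar x u p k - fbar x u q k| ≤ Cp * ‖p - q‖)
    (h Δt θ : ℝ) (hh : 0 < h) (hΔt : 0 < Δt) (hθ0 : 0 < θ)
    (hθ : Cp * (Δt / h) ≤ θ)
    (U V : (Fin d → ℤ) → ℝ) (hUV : ∀ i, U i ≤ V i) :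
    ∀ (i : Fin d → ℤ) (u k : ℝ),
      Δt * LFflux fbar h Δt θ U i u k + 2 * d * θ * U i
        ≤ Δt * LFflux fbar h Δt θ V i u k + 2 * d * θ * V i := by
  intro i u k
  rw [LFflux_add_center fbar θ hh.ne' hΔt.ne', LFflux_add_center fbar θ hh.ne' hΔt.ne']
  have hN := norm_dCent_sub_le hUV i
  have hN0 := norm_nonneg (dCent U i - dCent V i)
  have hlip := (le_abs_self _).trans (hfbar_lip (gridPt d h i) u
    ((1 / (2 * h)) • dCent U i) ((1 / (2 * h)) • dCent V i) k)
  rw [← smul_sub, norm_smul, Real.norm_of_nonneg (by positivity)] at hlip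
  have hflux := mul_le_mul_of_nonneg_left hlip hΔt.le
  have hscale : Δt * (Cp * (1 / (2 * h) * ‖dCent U i - dCent V i‖)) =
      Cp * (Δt / h) * (‖dCent U i - dCent V i‖ / 2) := by
    field_simp
  have hbound := mul_le_mul_of_nonneg_right hθ (div_nonneg hN0 zero_le_two)
  have hdiff := mul_le_mul_of_nonneg_left hN hθ0.le
  have hpos := mul_nonneg hθ0.le hN0
  linarith
end
end

section
/- ℓ∞-stability of the Lax–Friedrichs flux: let f̄ : ℝ^d×ℝ×ℝ^d×ℝ → ℝ satisfy |f̄(x,u,p,k) − f̄(x,u,q,k)| ≤ C_p|p−q| for all x,p,q ∈ ℝ^d and u,k ∈ ℝ, and let h, Δt, θ > 0 with λ := Δt/h and θ ≥ C_pλ. Then for all bounded U, V : ℤ^d → ℝ, every i ∈ ℤ^d and all u, k ∈ ℝ: | ( Δt f̃(x_i, u, ΔV_i, k) + 2dθ V_i ) − ( Δt f̃(x_i, u, ΔU_i, k) + 2dθ U_i ) | ≤ 2dθ · sup_{j∈ℤ^d} |U_j − V_j|. -/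
open Set Filter Topology

noncomputable section

/-- The Euclidean norm is bounded by the `ℓ¹` norm. -/
theorem euclidean_norm_le_sum_abs {ι : Type*} [Fintype ι] (a : EuclideanSpace ℝ ι) :
    ‖a‖ ≤ ∑ l, |a l| := by
  rw [EuclideanSpace.norm_eq]
  refine Real.sqrt_le_iff.2 ⟨Finset.sum_nonneg fun _ _ => abs_nonneg _, ?_⟩
  exact Finset.sum_sq_le_sq_sum_of_nonneg fun _ _ => abs_nonneg _

/-- A consequence of `|a - b| + |a + b| = 2 max(|a|, |b|)`. -/
theorem abs_sub_add_abs_add_le_two_mul {a b M : ℝ} (ha : |a| ≤ M) (hb : |b| ≤ M) :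
    |a - b| + |a + b| ≤ 2 * M := by
  rw [abs_le] at ha hb
  rcases abs_cases (a - b) with h1 | h1 <;> rcases abs_cases (a + b) with h2 | h2 <;> linarith

/-- `ℓ∞`-stability of the Lax–Friedrichs flux. -/
theorem lax_friedrichs_linfty_stability
    {d : ℕ} (Cp : ℝ) (hCp : 0 < Cp)
    (fbar : Vec d → ℝ → Vec d → ℝ → ℝ)
    (hfbar_lip : ∀ (x : Vec d) (u : ℝ) (p q : Vec d) (k : ℝ),
      |fbar x u p k - fbar x u q k| ≤ Cp * ‖p - q‖)
    (h Δt θ : ℝ) (hh : 0 < h) (hΔt : 0 < Δt) (hθ0 : 0 < θ)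
    (hθ : Cp * (Δt / h) ≤ θ)
    (U V : (Fin d → ℤ) → ℝ)
    (hU : ∃ M, ∀ i, |U i| ≤ M) (hV : ∃ M, ∀ i, |V i| ≤ M) :
    ∀ (i : Fin d → ℤ) (u k : ℝ),
      |(Δt * LFflux fbar h Δt θ V i u k + 2 * d * θ * V i)
        - (Δt * LFflux fbar h Δt θ U i u k + 2 * d * θ * U i)|
        ≤ 2 * d * θ * ⨆ j : Fin d → ℤ, |U j - V j| := by
  intro i u k
  set M : ℝ := ⨆ j : Fin d → ℤ, |U j - V j|
  obtain ⟨A, hA⟩ := hU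
  obtain ⟨B, hB⟩ := hV
  have hbdd : BddAbove (range fun j : Fin d → ℤ => |U j - V j|) :=
    ⟨A + B, by rintro _ ⟨j, rfl⟩; exact (abs_sub _ _).trans (add_le_add (hA j) (hB j))⟩
  have hW : ∀ j, |V j - U j| ≤ M := fun j => by
    rw [abs_sub_comm]; exact le_ciSup hbdd j
  let W : (Fin d → ℤ) → ℝ := fun j => V j - U j
  have hflux : ∀ Z : (Fin d → ℤ) → ℝ,
      Δt * LFflux fbar h Δt θ Z i u k + 2 * d * θ * Z i
        = Δt * fbar (gridPt d h i) u ((1 / (2 * h)) • dCent Z i) k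
          + θ * ∑ l : Fin d, (Z (i + unitZ d l) + Z (i - unitZ d l)) := by
    intro Z
    have hsum : ∑ l : Fin d, (dPlus Z l i - dMinus Z l i)
        = ∑ l : Fin d, (Z (i + unitZ d l) + Z (i - unitZ d l)) - 2 * d * Z i := by
      have : (2 * d * Z i : ℝ) = ∑ _l : Fin d, 2 * Z i := by simp; ring
      rw [this, ← Finset.sum_sub_distrib]
      refine Finset.sum_congr rfl fun l _ => ?_
      simp only [dPlus, dMinus]; ring
    rw [LFflux, ← Finset.sum_div, hsum]
    field_simp
    ring
  have hnorm : ‖(1 / (2 * h)) • dCent V i - (1 / (2 * h)) • dCent U i‖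
      ≤ 1 / (2 * h) * ∑ l : Fin d, |W (i + unitZ d l) - W (i - unitZ d l)| := by
    rw [← smul_sub, norm_smul, Real.norm_of_nonneg (by positivity)]
    refine mul_le_mul_of_nonneg_left ((euclidean_norm_le_sum_abs _).trans_eq ?_) (by positivity)
    refine Finset.sum_congr rfl fun l _ => ?_
    simp only [dCent, dPlus, dMinus, W, PiLp.sub_apply, PiLp.coe_symm_continuousLinearEquiv,
      EuclideanSpace.equiv]
    congr 1
    ring
  have hfbar : Δt * |fbar (gridPt d h i) u ((1 / (2 * h)) • dCent V i) k
        - fbar (gridPt d h i) u ((1 / (2 * h)) • dCent U i) k|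
      ≤ θ * ∑ l : Fin d, |W (i + unitZ d l) - W (i - unitZ d l)| := by
    set S := ∑ l : Fin d, |W (i + unitZ d l) - W (i - unitZ d l)|
    have hS : 0 ≤ S := Finset.sum_nonneg fun _ _ => abs_nonneg _
    calc _ ≤ Δt * (Cp * (1 / (2 * h) * S)) := by
          gcongr
          exact (hfbar_lip _ _ _ _ _).trans (by gcongr)
      _ = Cp * (Δt / h) * (S / 2) := by field_simp
      _ ≤ θ * (S / 2) := by gcongr
      _ ≤ θ * S := by gcongr; linarith
  have hsplit : (Δt * LFflux fbar h Δt θ V i u k + 2 * d * θ * V i)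
        - (Δt * LFflux fbar h Δt θ U i u k + 2 * d * θ * U i)
      = Δt * (fbar (gridPt d h i) u ((1 / (2 * h)) • dCent V i) k
          - fbar (gridPt d h i) u ((1 / (2 * h)) • dCent U i) k)
        + θ * ∑ l : Fin d, (W (i + unitZ d l) + W (i - unitZ d l)) := by
    have : ∑ l : Fin d, (W (i + unitZ d l) + W (i - unitZ d l))
        = ∑ l : Fin d, (V (i + unitZ d l) + V (i - unitZ d l))
          - ∑ l : Fin d, (U (i + unitZ d l) + U (i - unitZ d l)) := by
      rw [← Finset.sum_sub_distrib]
      exact Finset.sum_congr rfl fun l _ => by simp only [W]; ring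
    rw [hflux, hflux, this]
    ring
  rw [hsplit]
  refine (abs_add_le _ _).trans ?_
  rw [abs_mul, abs_mul, abs_of_pos hΔt, abs_of_pos hθ0]
  calc _ ≤ θ * ∑ l : Fin d, |W (i + unitZ d l) - W (i - unitZ d l)|
        + θ * ∑ l : Fin d, |W (i + unitZ d l) + W (i - unitZ d l)| := by
        gcongr
        exact Finset.abs_sum_le_sum_abs _ _
    _ = θ * ∑ l : Fin d, (|W (i + unitZ d l) - W (i - unitZ d l)|
        + |W (i + unitZ d l) + W (i - unitZ d l)|) := by
        rw [Finset.sum_add_distrib, mul_add]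
    _ ≤ θ * ∑ _l : Fin d, 2 * M := by
        gcongr
        exact abs_sub_add_abs_add_le_two_mul (hW _) (hW _)
    _ = 2 * d * θ * M := by simp; ring
end
end
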